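/- The map E : β ↦ (g ↦ (z ↦ exp(2πi·β(g)(z)))) is a bijection from the space Z¹_cont(ℝⁿ, Map(𝕋ⁿ, ℝ)) of continuous ℝ-valued cocycles onto the space Z¹_cont(ℝⁿ, Map(𝕋ⁿ, U(1))) of continuous U(1)-valued cocycles, and E is a homeomorphism with respect to the subspace topologies inherited from the compact-open topologies on C(ℝⁿ, C(𝕋ⁿ, ℝ)) and C(ℝⁿ, C(𝕋ⁿ, U(1))). -/

import Mathlib

/-!
The exponential map `E : β ↦ (g ↦ (z ↦ exp(2πi·β(g)(z))))` is a bijection from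
the space of continuous `ℝ`-valued cocycles onto the space of continuous
`U(1)`-valued cocycles, and it is a homeomorphism for the (subspace of the)
compact-open topologies.
-/

noncomputable section

/-- The `n`-torus `𝕋ⁿ = ℝⁿ/ℤⁿ`. -/
abbrev Torus (n : ℕ) : Type := Fin n → AddCircle (1 : ℝ)

/-- The quotient homomorphism `p : ℝⁿ → 𝕋ⁿ`. -/
def torusProj (n : ℕ) : (Fin n → ℝ) → Torus n := fun v i => (v i : AddCircle (1 : ℝ))

/-- The space `Z¹_cont(ℝⁿ, Map(𝕋ⁿ, U(1)))` of continuous `U(1)`-valued cocycles. -/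
abbrev CocycleU1 (n : ℕ) : Type :=
  {α : C(Fin n → ℝ, C(Torus n, Circle)) //
    ∀ (g h : Fin n → ℝ) (z : Torus n),
      α (g + h) z = α g (z + torusProj n h) * α h z}

/-- The space `Z¹_cont(ℝⁿ, Map(𝕋ⁿ, ℝ))` of continuous `ℝ`-valued cocycles. -/
abbrev CocycleR (n : ℕ) : Type :=
  {β : C(Fin n → ℝ, C(Torus n, ℝ)) //
    ∀ (g h : Fin n → ℝ) (z : Torus n),
      β (g + h) z = β g (z + torusProj n h) + β h z}

open scoped unitInterval

/-- A circle-valued map on `A × V` that equals `1` on `A × {0}` has a real logarithm that vanishes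
on `A × {0}`. -/
theorem exists_continuousMap_circleExp_eq {A V : Type*} [TopologicalSpace A] [TopologicalSpace V]
    [AddCommGroup V] [Module ℝ V] [ContinuousSMul ℝ V] (f : C(A × V, Circle))
    (hf : ∀ a, f (a, 0) = 1) :
    ∃ L : C(A × V, ℝ), (∀ x, Circle.exp (L x) = f x) ∧ ∀ a, L (a, 0) = 0 := by
  let H : C(I × (A × V), Circle) :=
    ⟨fun x => f (x.2.1, (x.1 : ℝ) • x.2.2), by fun_prop⟩
  have H_zero : ∀ x, H (0, x) = Circle.exp ((0 : C(A × V, ℝ)) x) := fun x => by simp [H, hf]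
  let G := Circle.isCoveringMap_exp.liftHomotopy H 0 H_zero
  have hG (x) : Circle.exp (G x) = H x :=
    congrFun (Circle.isCoveringMap_exp.liftHomotopy_lifts H 0 H_zero) x
  refine ⟨G.comp ⟨fun x => (1, x), by fun_prop⟩, fun x => ?_, fun a => ?_⟩
  · simpa [H] using hG (1, x)
  · have hG0 : G (0, (a, 0)) = 0 := Circle.isCoveringMap_exp.liftHomotopy_zero H 0 H_zero _
    have hconst : (fun t : I => G (t, (a, 0))) = fun _ => 0 :=
      Circle.isCoveringMap_exp.eq_of_comp_eq (by fun_prop) continuous_const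
        (funext fun t => by simp [hG, H, hf]) 0 hG0
    exact congrFun hconst 1

/-- The exponential map `β ↦ (g ↦ (z ↦ exp(2πi·β(g)(z))))` on cocycles. -/
def expCocycle (n : ℕ) (β : CocycleR n) : CocycleU1 n :=
  ⟨(⟨(⟨fun x : ℝ => Circle.exp (2 * Real.pi * x), by fun_prop⟩ : C(ℝ, Circle)).comp,
      ContinuousMap.continuous_postcomp _⟩ : C(C(Torus n, ℝ), C(Torus n, Circle))).comp β.1,
    fun g h z => by simp [β.2, mul_add, Circle.exp_add]⟩

theorem expCocycle_apply {n : ℕ} (β : CocycleR n) (g : Fin n → ℝ) (z : Torus n) :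
    (expCocycle n β).1 g z = Circle.exp (2 * Real.pi * β.1 g z) := rfl

theorem continuous_expCocycle (n : ℕ) : Continuous (expCocycle n) :=
  ((ContinuousMap.continuous_postcomp _).comp continuous_subtype_val).subtype_mk _

theorem torusProj_zero (n : ℕ) : torusProj n 0 = 0 := by
  ext i; simp [torusProj]

theorem CocycleR.map_zero {n : ℕ} (β : CocycleR n) (z : Torus n) : β.1 0 z = 0 := by
  simpa [torusProj_zero] using β.2 0 0 z

theorem CocycleU1.map_zero {n : ℕ} (α : CocycleU1 n) (z : Torus n) : α.1 0 z = 1 := by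
  simpa [torusProj_zero] using α.2 0 0 z

theorem continuous_torusProj (n : ℕ) : Continuous (torusProj n) :=
  continuous_pi fun i => (AddCircle.continuous_mk' 1).comp (continuous_apply i)

theorem expCocycle_injective (n : ℕ) : Function.Injective (expCocycle n) := by
  intro β γ h
  ext g z
  have key : (fun g => 2 * Real.pi * β.1 g z) = fun g => 2 * Real.pi * γ.1 g z :=
    Circle.isCoveringMap_exp.eq_of_comp_eq (by fun_prop) (by fun_prop)
      (funext fun g => by
        simp only [Function.comp_apply, ← expCocycle_apply, h]) 0
      (by simp [CocycleR.map_zero])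
  have := congrFun key g
  simpa [Real.pi_ne_zero] using this

/-- The exponential map on cocycles has a continuous right inverse. -/
theorem exists_continuous_rightInverse_expCocycle (n : ℕ) :
    ∃ F : CocycleU1 n → CocycleR n, Continuous F ∧ Function.RightInverse F (expCocycle n) := by
  have hev : Continuous fun x : (CocycleU1 n × Torus n) × (Fin n → ℝ) => x.1.1.1 x.2 x.1.2 := by
    fun_prop
  obtain ⟨L, hL, hL0⟩ := exists_continuousMap_circleExp_eq ⟨_, hev⟩
    fun a => CocycleU1.map_zero a.1 a.2
  have hLadd (α : CocycleU1 n) (g h : Fin n → ℝ) (z : Torus n) :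
      L ((α, z), g + h) = L ((α, z + torusProj n h), g) + L ((α, z), h) := by
    have hp := continuous_torusProj n
    have key : (fun x : (Fin n → ℝ) × (Fin n → ℝ) => L ((α, z), x.1 + x.2)) =
        fun x => L ((α, z + torusProj n x.2), x.1) + L ((α, z), x.2) :=
      Circle.isCoveringMap_exp.eq_of_comp_eq (by fun_prop) (by fun_prop)
        (funext fun x => by simp [Circle.exp_add, hL, α.2]) 0 (by simp [hL0])
    exact congrFun key (g, h)
  let K : C(CocycleU1 n × (Fin n → ℝ) × Torus n, ℝ) :=
    ⟨fun x => L ((x.1, x.2.2), x.2.1) / (2 * Real.pi), by fun_prop⟩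
  refine ⟨fun α => ⟨(K.curry α).curry, fun g h z => ?_⟩, ?_, fun α => ?_⟩
  · simp [K, hLadd, add_div]
  · exact (ContinuousMap.continuous_curry.comp K.curry.continuous).subtype_mk _
  · ext g z : 3
    rw [expCocycle_apply]
    have h2 : 2 * Real.pi * (L ((α, z), g) / (2 * Real.pi)) = L ((α, z), g) := by
      field_simp
    exact (congrArg Circle.exp h2).trans (hL _)

/-- Exponentiation is a homeomorphism (in particular a bijection)
`Z¹_cont(ℝⁿ, Map(𝕋ⁿ, ℝ)) ≃ Z¹_cont(ℝⁿ, Map(𝕋ⁿ, U(1)))`. -/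
theorem exp_cocycle_homeomorph (n : ℕ) :
    ∃ F : CocycleR n ≃ₜ CocycleU1 n,
      ∀ (β : CocycleR n) (g : Fin n → ℝ) (z : Torus n),
        (F β).1 g z = Circle.exp (2 * Real.pi * β.1 g z) := by
  obtain ⟨F, hF, hright⟩ := exists_continuous_rightInverse_expCocycle n
  exact ⟨{ toFun := expCocycle n
           invFun := F
           left_inv := hright.leftInverse_of_injective (expCocycle_injective n)
           right_inv := hright
           continuous_toFun := continuous_expCocycle n
           continuous_invFun := hF }, expCocycle_apply⟩
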